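/- Let X be a real Banach space satisfying condition (II), κ an uncountable regular cardinal, and {x_α}_{α<κ} ⊆ X∖{0}. Then the following are equivalent: (a) {x_α}_{α<κ} is strongly dispersed; (b) {x_α}_{α<κ} is weakly null; (c) {x_α}_{α<κ} is σ(X,Z)-null for every separating subspace Z ⊆ X*. -/

import Mathlib

open Cardinal Ordinal Set Pointwise

universe u

noncomputable def closedSpan {X : Type u} [SeminormedAddCommGroup X] [NormedSpace ℝ X]
    (s : Set X) : Submodule ℝ X :=
  (Submodule.span ℝ s).topologicalClosure

def IsDispersed {X : Type u} [SeminormedAddCommGroup X] [NormedSpace ℝ X]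
    (x : Ordinal.{u} → X) (lam : Ordinal.{u}) : Prop :=
  ∀ β < lam,
    (⋂ γ ∈ Set.Iio lam, (closedSpan (x '' {α | γ < α ∧ α < lam}) : Set X)) ⊂
      (closedSpan (x '' {α | β < α ∧ α < lam}) : Set X)

def IsStronglyDispersed {X : Type u} [SeminormedAddCommGroup X] [NormedSpace ℝ X]
    (x : Ordinal.{u} → X) (lam : Ordinal.{u}) : Prop :=
  IsDispersed x lam ∧
    (⋂ β ∈ Set.Iio lam, (closedSpan (x '' {α | β < α ∧ α < lam}) : Set X)) = {0}

/-- condition (II) -/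
def CondII (X : Type u) [SeminormedAddCommGroup X] [NormedSpace ℝ X] : Prop :=
  ∀ κ : Cardinal.{u}, κ.IsRegular → ℵ₀ < κ →
    ∀ Z : Ordinal.{u} → Submodule ℝ X,
      (∀ α < κ.ord, IsClosed ((Z α : Set X))) →
      (∀ α β, α ≤ β → β < κ.ord → Z β ≤ Z α) →
      ∀ f : X →L[ℝ] ℝ, (∀ v ∈ ⋂ α ∈ Set.Iio κ.ord, (Z α : Set X), f v = 0) →
        ∃ α < κ.ord, ∀ v ∈ Z α, f v = 0

def IsWeaklyNull {X : Type u} [SeminormedAddCommGroup X] [NormedSpace ℝ X]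
    (x : Ordinal.{u} → X) (θ : Ordinal.{u}) : Prop :=
  ∀ f : X →L[ℝ] ℝ, ∀ ε > (0:ℝ), ∃ β < θ, ∀ α, β < α → α < θ → |f (x α)| < ε

def IsSigmaNull {X : Type u} [SeminormedAddCommGroup X] [NormedSpace ℝ X]
    (Z : Submodule ℝ (X →L[ℝ] ℝ)) (x : Ordinal.{u} → X) (θ : Ordinal.{u}) : Prop :=
  ∀ f ∈ Z, ∀ ε > (0:ℝ), ∃ β < θ, ∀ α, β < α → α < θ → |f (x α)| < ε

/-- `Z ⊆ X*` is a separating subspace -/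
def SeparatingSubspace {X : Type u} [SeminormedAddCommGroup X] [NormedSpace ℝ X]
    (Z : Submodule ℝ (X →L[ℝ] ℝ)) : Prop :=
  ∀ x : X, x ≠ 0 → ∃ f ∈ Z, f x ≠ 0

section TransfiniteSequences

variable {X : Type u} [SeminormedAddCommGroup X] [NormedSpace ℝ X]

theorem isClosed_closedSpan (s : Set X) : IsClosed (closedSpan s : Set X) :=
  Submodule.isClosed_topologicalClosure _

theorem subset_closedSpan (s : Set X) : s ⊆ closedSpan s :=
  Submodule.subset_span.trans (Submodule.le_topologicalClosure _)

theorem closedSpan_mono {s t : Set X} (h : s ⊆ t) : closedSpan s ≤ closedSpan t :=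
  Submodule.topologicalClosure_mono (Submodule.span_mono h)

theorem apply_eq_zero_of_mem_closedSpan {s : Set X} {f : X →L[ℝ] ℝ} (h : ∀ v ∈ s, f v = 0)
    {v : X} (hv : v ∈ closedSpan s) : f v = 0 := by
  have hle : closedSpan s ≤ LinearMap.ker (f : X →ₗ[ℝ] ℝ) :=
    Submodule.topologicalClosure_minimal _
      (Submodule.span_le.2 fun w hw => LinearMap.mem_ker.2 (h w hw)) f.isClosed_ker
  exact LinearMap.mem_ker.1 (hle hv)

theorem IsWeaklyNull.exists_forall_apply_eq_zero {κ : Cardinal.{u}} (hreg : κ.IsRegular)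
    (hunc : ℵ₀ < κ) {x : Ordinal.{u} → X} (h : IsWeaklyNull x κ.ord) (f : X →L[ℝ] ℝ) :
    ∃ β < κ.ord, ∀ α, β < α → α < κ.ord → f (x α) = 0 := by
  choose b hb hlt using fun n : ℕ => h f (1 / ((n : ℝ) + 1)) (by positivity)
  refine ⟨⨆ n, b n, ?_, fun α hα hακ => ?_⟩
  · exact Ordinal.lift_iSup_lt_of_lt_cof (by simpa [hreg.cof_ord] using hunc) hb
  · by_contra hne
    obtain ⟨n, hn⟩ := exists_nat_one_div_lt (abs_pos.2 hne)
    exact (hn.trans (hlt n α ((Ordinal.le_iSup b n).trans_lt hα) hακ)).false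

theorem IsStronglyDispersed.isWeaklyNull (hII : CondII X) {κ : Cardinal.{u}}
    (hreg : κ.IsRegular) (hunc : ℵ₀ < κ) {x : Ordinal.{u} → X}
    (h : IsStronglyDispersed x κ.ord) : IsWeaklyNull x κ.ord := by
  intro f ε hε
  obtain ⟨β, hβ, hf⟩ := hII κ hreg hunc (fun β => closedSpan (x '' {α | β < α ∧ α < κ.ord}))
    (fun _ _ => isClosed_closedSpan _)
    (fun α β hαβ _ => closedSpan_mono (Set.image_mono fun _ hγ => ⟨hαβ.trans_lt hγ.1, hγ.2⟩)) f
    (fun v hv => by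
      rw [h.2, Set.mem_singleton_iff] at hv
      rw [hv, map_zero])
  refine ⟨β, hβ, fun α hα hακ => ?_⟩
  rw [hf _ (subset_closedSpan _ (Set.mem_image_of_mem x ⟨hα, hακ⟩)), abs_zero]
  exact hε

end TransfiniteSequences

theorem separatingSubspace_top {X : Type u} [NormedAddCommGroup X] [NormedSpace ℝ X] :
    SeparatingSubspace (⊤ : Submodule ℝ (X →L[ℝ] ℝ)) := fun _ hv =>
  let ⟨f, hf⟩ := SeparatingDual.exists_ne_zero (R := ℝ) hv
  ⟨f, Submodule.mem_top, hf⟩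

theorem IsWeaklyNull.isStronglyDispersed {X : Type u} [NormedAddCommGroup X] [NormedSpace ℝ X]
    {κ : Cardinal.{u}} (hreg : κ.IsRegular) (hunc : ℵ₀ < κ) {x : Ordinal.{u} → X}
    (hne : ∀ α < κ.ord, x α ≠ 0) (h : IsWeaklyNull x κ.ord) : IsStronglyDispersed x κ.ord := by
  have hzero : (⋂ β ∈ Set.Iio κ.ord,
      (closedSpan (x '' {α | β < α ∧ α < κ.ord}) : Set X)) = {0} := by
    refine Set.Subset.antisymm (fun v hv => ?_) ?_
    · by_contra hv0
      obtain ⟨f, hf⟩ := SeparatingDual.exists_ne_zero (R := ℝ) hv0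
      obtain ⟨β, hβ, hfβ⟩ := h.exists_forall_apply_eq_zero hreg hunc f
      refine hf (apply_eq_zero_of_mem_closedSpan ?_ (Set.mem_iInter₂.1 hv β hβ))
      rintro _ ⟨α, ⟨hα, hακ⟩, rfl⟩
      exact hfβ α hα hακ
    · simp
  refine ⟨fun β hβ => ?_, hzero⟩
  rw [hzero]
  have hsucc : Order.succ β < κ.ord := (Cardinal.isSuccLimit_ord hreg.aleph0_le).succ_lt hβ
  refine Set.ssubset_iff_subset_ne.2 ⟨by simp, fun heq => hne _ hsucc ?_⟩
  have hmem := subset_closedSpan _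
    (Set.mem_image_of_mem x (show Order.succ β ∈ {α | β < α ∧ α < κ.ord} from
      ⟨Order.lt_succ β, hsucc⟩))
  rwa [← heq] at hmem

theorem stmt6 {X : Type u} [NormedAddCommGroup X] [NormedSpace ℝ X] [CompleteSpace X]
    (hII : CondII X)
    (κ : Cardinal.{u}) (hreg : κ.IsRegular) (hunc : ℵ₀ < κ)
    (x : Ordinal.{u} → X) (hne : ∀ α < κ.ord, x α ≠ 0) :
    (IsStronglyDispersed x κ.ord ↔ IsWeaklyNull x κ.ord) ∧
    (IsWeaklyNull x κ.ord ↔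
      ∀ Z : Submodule ℝ (X →L[ℝ] ℝ), SeparatingSubspace Z → IsSigmaNull Z x κ.ord) := by
  refine ⟨⟨fun h => h.isWeaklyNull hII hreg hunc, fun h => h.isStronglyDispersed hreg hunc hne⟩,
    fun h _ _ f _ => h f, fun h f => h ⊤ separatingSubspace_top f Submodule.mem_top⟩
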